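/- Let G be a finite group, V a finite-dimensional faithful F_p-representation of G with p dividing |G|, and P a Sylow p-subgroup. Suppose x_1, ..., x_n are homogeneous elements of positive degree in F_p[V]^G whose images under the restriction F_p[V]^G → F_p[C] (restriction of polynomial functions to a subspace C ⊆ V^P) form a regular sequence in F_p[C]. Then x_1, ..., x_n is a regular sequence in F_p[V]^G. In particular depth(F_p[V]^G) ≥ dim_{F_p}(V^P). -/

import Mathlib

set_option synthInstance.maxHeartbeats 1000000
set_option maxHeartbeats 1000000

noncomputable section

/-- The submodule `(y_0, ..., y_{j-1})M` generated by the first `j` entries of the sequence. -/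
def seqSubmodule {P : Type*} (M : Type*) [Ring P] [AddCommGroup M] [Module P M]
    {n : ℕ} (y : Fin n → P) (j : ℕ) : Submodule P M :=
  Submodule.span P {m : M | ∃ l : Fin n, (l : ℕ) < j ∧ ∃ x : M, m = y l • x}

/-- `y` is an `M`-regular sequence: each `y i` is a non-zero-divisor on
`M/(y_0,...,y_{i-1})M`, and `(y_0,...,y_{n-1})M ≠ M`. -/
def IsRegSeq {P : Type*} (M : Type*) [Ring P] [AddCommGroup M] [Module P M]
    {n : ℕ} (y : Fin n → P) : Prop :=
  (∀ i : Fin n, ∀ x : M, y i • x ∈ seqSubmodule M y (i : ℕ) → x ∈ seqSubmodule M y (i : ℕ))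
    ∧ seqSubmodule M y n ≠ ⊤

/-- The depth of `M` with respect to the ideal `I`: the supremum of lengths of
`M`-regular sequences consisting of elements of `I`. -/
def depth (P M : Type*) [Ring P] [AddCommGroup M] [Module P M] (I : Ideal P) : ℕ :=
  sSup {n : ℕ | ∃ y : Fin n → P, (∀ i, y i ∈ I) ∧ IsRegSeq M y}

/-- The irrelevant ideal of positive-degree elements of a graded algebra. -/
def irrelevant {k R : Type*} [Field k] [CommRing R] [Algebra k R]
    (𝒜 : ℕ → Submodule k R) : Ideal R :=
  Ideal.span {x : R | ∃ i, 0 < i ∧ x ∈ 𝒜 i}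

/-- Connectedness: the degree-zero part consists exactly of scalars. -/
def GradedConnected {k R : Type*} [Field k] [CommRing R] [Algebra k R]
    (𝒜 : ℕ → Submodule k R) : Prop :=
  ∀ x ∈ 𝒜 0, ∃ c : k, x = algebraMap k R c

end
noncomputable section

open MvPolynomial

variable {p n : ℕ} [Fact (Nat.Prime p)] {G : Type*} [Group G] [Fintype G]

/-- The subalgebra of `K`-invariants of `F_p[V] = F_p[x_1,...,x_n]` under the action
`σ` of `G` induced by a representation of `G` on `V`. -/
def fixedSub (σ : G →* (MvPolynomial (Fin n) (ZMod p) ≃ₐ[ZMod p] MvPolynomial (Fin n) (ZMod p)))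
    (K : Subgroup G) : Subalgebra (ZMod p) (MvPolynomial (Fin n) (ZMod p)) :=
  ⨅ g ∈ K, AlgHom.equalizer (σ g : MvPolynomial (Fin n) (ZMod p) →ₐ[ZMod p] MvPolynomial (Fin n) (ZMod p))
    (AlgHom.id (ZMod p) (MvPolynomial (Fin n) (ZMod p)))

/-- `T` is a set of representatives for the left cosets of `H` in `G`. -/
def IsTransversal (H : Subgroup G) (T : Finset G) : Prop :=
  ∀ q : G ⧸ H, ∃! t, t ∈ T ∧ (QuotientGroup.mk t : G ⧸ H) = q

/-- The action `σ` on `F_p[x_1,...,x_n]` is the one induced (contragrediently) by the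
representation `ρ` of `G` on `V = (F_p)^n`: on the coordinate functions `x_i` it is given by
substituting the linear forms determined by `ρ g⁻¹`. -/
def InducedAction (ρ : Representation (ZMod p) G (Fin n → ZMod p))
    (σ : G →* (MvPolynomial (Fin n) (ZMod p) ≃ₐ[ZMod p] MvPolynomial (Fin n) (ZMod p))) : Prop :=
  ∀ (g : G) (i : Fin n), σ g (X i) =
    ∑ j : Fin n, C ((ρ g⁻¹) (Pi.single j (1 : ZMod p)) i) * X j

open MvPolynomial

section RegularMod

variable {R : Type*} [CommRing R]

/-- The ideal generated by the first `i` terms of a sequence. -/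
def initialIdeal (a : ℕ → R) (i : ℕ) : Ideal R :=
  Ideal.span (a '' Set.Iio i)

/-- The first `N` terms of `a` form a weakly regular sequence on `R ⧸ I`. -/
def IsRegularMod (I : Ideal R) (N : ℕ) (a : ℕ → R) : Prop :=
  ∀ i < N, ∀ f, a i * f ∈ I ⊔ initialIdeal a i → f ∈ I ⊔ initialIdeal a i

theorem initialIdeal_zero (a : ℕ → R) : initialIdeal a 0 = ⊥ := by
  simp [initialIdeal]

theorem initialIdeal_succ (a : ℕ → R) (i : ℕ) :
    initialIdeal a (i + 1) = initialIdeal a i ⊔ Ideal.span {a i} := by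
  rw [initialIdeal, initialIdeal, ← Ideal.span_union, ← Set.image_singleton, ← Set.image_union]
  congr 2
  ext j
  simp only [Set.mem_Iio, Set.union_singleton, Set.mem_insert_iff]
  lia

theorem initialIdeal_succ' (a : ℕ → R) (i : ℕ) :
    initialIdeal a (i + 1) = Ideal.span {a 0} ⊔ initialIdeal (fun j => a (j + 1)) i := by
  induction i with
  | zero => simp [initialIdeal_succ, initialIdeal_zero]
  | succ i ih => rw [initialIdeal_succ, ih, initialIdeal_succ _ i, sup_assoc]

theorem mem_initialIdeal (a : ℕ → R) {i j : ℕ} (h : i < j) : a i ∈ initialIdeal a j :=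
  Ideal.subset_span ⟨i, h, rfl⟩

theorem isRegularMod_top (N : ℕ) (a : ℕ → R) : IsRegularMod ⊤ N a := by
  intro i _ f _
  simp

theorem IsRegularMod.cons {I : Ideal R} {N : ℕ} {a : ℕ → R}
    (h0 : ∀ f, a 0 * f ∈ I → f ∈ I)
    (h : IsRegularMod (I ⊔ Ideal.span {a 0}) N (fun j => a (j + 1))) :
    IsRegularMod I (N + 1) a := by
  rintro (_ | i) hi f hf
  · simp only [initialIdeal_zero, sup_bot_eq] at hf ⊢
    exact h0 f hf
  · rw [initialIdeal_succ', ← sup_assoc] at hf ⊢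
    exact h i (by lia) f hf

/-- If a sequence is regular modulo `K`, then `K ∩ (a_0, …, a_{i-1}) ⊆ (a_0, …, a_{i-1}) K`. -/
theorem IsRegularMod.inf_initialIdeal_le {K : Ideal R} {N : ℕ} {a : ℕ → R}
    (h : IsRegularMod K N a) {i : ℕ} (hi : i ≤ N) {f : R} (hK : f ∈ K)
    (hf : f ∈ initialIdeal a i) : f ∈ initialIdeal a i * K := by
  induction i generalizing f with
  | zero => rw [initialIdeal_zero] at hf ⊢; simpa using hf
  | succ i ih =>
    rw [initialIdeal_succ, Submodule.mem_sup] at hf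
    obtain ⟨u, hu, v, hv, rfl⟩ := hf
    obtain ⟨g, rfl⟩ := Ideal.mem_span_singleton.1 hv
    have hg : g ∈ K ⊔ initialIdeal a i := by
      refine h i hi g ?_
      have : a i * g = (u + a i * g) - u := by ring
      rw [this]
      exact sub_mem (Ideal.mem_sup_left hK) (Ideal.mem_sup_right hu)
    obtain ⟨m, hm, j, hj, rfl⟩ := Submodule.mem_sup.1 hg
    have h1 : u + a i * j ∈ initialIdeal a i * K := by
      refine ih (by lia) ?_ (add_mem hu (Ideal.mul_mem_left _ _ hj))
      have : u + a i * j = (u + a i * (m + j)) - a i * m := by ring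
      rw [this]
      exact sub_mem hK (Ideal.mul_mem_left _ _ hm)
    have : u + a i * (m + j) = (u + a i * j) + a i * m := by ring
    rw [this, initialIdeal_succ, Ideal.sup_mul]
    exact add_mem (Ideal.mem_sup_left h1)
      (Ideal.mem_sup_right (Ideal.mul_mem_mul (Ideal.mem_span_singleton_self _) hm))

/-- Weak regularity on `R ⧸ K` follows from weak regularity on a quotient of `R ⧸ K` and on the
kernel of the quotient map. -/
theorem IsRegularMod.of_le {K K' : Ideal R} (hle : K ≤ K') {N : ℕ} {a : ℕ → R}
    (h : IsRegularMod K' N a)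
    (hs : ∀ i < N, ∀ f ∈ K', a i * f ∈ K ⊔ initialIdeal a i * K' →
      f ∈ K ⊔ initialIdeal a i * K') :
    IsRegularMod K N a := by
  intro i hi f hf
  have hle' : K ⊔ initialIdeal a i ≤ K' ⊔ initialIdeal a i := sup_le_sup_right hle _
  have hle'' : K ⊔ initialIdeal a i * K' ≤ K ⊔ initialIdeal a i :=
    sup_le_sup_left Ideal.mul_le_left _
  obtain ⟨m, hm, j, hj, rfl⟩ := Submodule.mem_sup.1 (h i hi f (hle' hf))
  obtain ⟨k, hk, u, hu, hku⟩ := Submodule.mem_sup.1 hf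
  have hu' : u - a i * j ∈ initialIdeal a i * K' := by
    refine h.inf_initialIdeal_le hi.le ?_ (sub_mem hu (Ideal.mul_mem_left _ _ hj))
    have : u - a i * j = a i * m - k := by linear_combination hku
    rw [this]
    exact sub_mem (Ideal.mul_mem_left _ _ hm) (hle hk)
  have hm' : m ∈ K ⊔ initialIdeal a i * K' := by
    refine hs i hi m hm ?_
    have : a i * m = k + (u - a i * j) := by linear_combination -hku
    rw [this]
    exact add_mem (Ideal.mem_sup_left hk) (Ideal.mem_sup_right hu')
  exact add_mem (hle'' hm') (Ideal.mem_sup_right hj)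

theorem IsRegularMod.of_filtration {N : ℕ} {a : ℕ → R} (F : ℕ → Ideal R) (h0 : F 0 = ⊤)
    (hF : ∀ D, F (D + 1) ≤ F D)
    (hgr : ∀ D, ∀ i < N, ∀ f ∈ F D, a i * f ∈ F (D + 1) ⊔ initialIdeal a i * F D →
      f ∈ F (D + 1) ⊔ initialIdeal a i * F D) (D : ℕ) :
    IsRegularMod (F D) N a := by
  induction D with
  | zero => rw [h0]; exact isRegularMod_top N a
  | succ D ih => exact ih.of_le (hF D) (hgr D)

theorem mul_mem_sup_span_mul_iff {I J : Ideal R} {w v : R} (hw : ∀ f, w * f ∈ I → f ∈ I)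
    (f : R) :
    w * f ∈ (I ⊔ Ideal.span {w * v}) ⊔ J * (I ⊔ Ideal.span {w}) ↔
      f ∈ (I ⊔ Ideal.span {v}) ⊔ J := by
  constructor
  · intro h
    have hle : (I ⊔ Ideal.span {w * v}) ⊔ J * (I ⊔ Ideal.span {w}) ≤
        I ⊔ Ideal.span {w} * (Ideal.span {v} ⊔ J) := by
      have hJI : J * I ≤ I := Ideal.mul_le_right
      have e1 : J * (I ⊔ Ideal.span {w}) = J * I ⊔ Ideal.span {w} * J := by
        rw [Ideal.mul_sup, mul_comm J (Ideal.span {w})]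
      have e2 : Ideal.span {w} * (Ideal.span {v} ⊔ J) =
          Ideal.span {w * v} ⊔ Ideal.span {w} * J := by
        rw [Ideal.mul_sup, Ideal.span_singleton_mul_span_singleton]
      rw [e1, e2]
      exact sup_le (sup_le le_sup_left (le_sup_of_le_right le_sup_left))
        (sup_le (hJI.trans le_sup_left) (le_sup_of_le_right le_sup_right))
    obtain ⟨k, hk, u, hu, hku⟩ := Submodule.mem_sup.1 (hle h)
    obtain ⟨z, hz, rfl⟩ := Ideal.mem_span_singleton_mul.1 hu
    have h3 : f - z ∈ I := hw _ (by
      have : w * (f - z) = k := by linear_combination -hku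
      rwa [this])
    rw [sup_assoc, ← sub_add_cancel f z]
    exact add_mem (Ideal.mem_sup_left h3) (Ideal.mem_sup_right hz)
  · intro h
    obtain ⟨y, hy, j, hj, rfl⟩ := Submodule.mem_sup.1 h
    obtain ⟨k, hk, u, hu, rfl⟩ := Submodule.mem_sup.1 hy
    obtain ⟨g, rfl⟩ := Ideal.mem_span_singleton.1 hu
    have hw' : w ∈ I ⊔ Ideal.span {w} := Ideal.mem_sup_right (Ideal.mem_span_singleton_self w)
    have hv : w * (v * g) ∈ Ideal.span {w * v} :=
      Ideal.mem_span_singleton.2 ⟨g, by ring⟩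
    rw [mul_add, mul_add, mul_comm w j]
    exact add_mem (Ideal.mem_sup_left (add_mem
      (Ideal.mem_sup_left (Ideal.mul_mem_left _ _ hk)) (Ideal.mem_sup_right hv)))
      (Ideal.mem_sup_right (Ideal.mul_mem_mul hj hw'))

theorem IsRegularMod.sup_mul {I : Ideal R} {N : ℕ} {a : ℕ → R} {w v : R}
    (hw : ∀ f, w * f ∈ I → f ∈ I)
    (h1 : IsRegularMod (I ⊔ Ideal.span {w}) N a) (h2 : IsRegularMod (I ⊔ Ideal.span {v}) N a) :
    IsRegularMod (I ⊔ Ideal.span {w * v}) N a := by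
  have hle : Ideal.span {w * v} ≤ Ideal.span {w} :=
    Ideal.span_singleton_le_span_singleton.2 (dvd_mul_right _ _)
  refine h1.of_le (sup_le_sup le_rfl hle) fun i hi f hf haf => ?_
  obtain ⟨k, hk, u, hu, rfl⟩ := Submodule.mem_sup.1 hf
  obtain ⟨g, rfl⟩ := Ideal.mem_span_singleton.1 hu
  refine add_mem (Ideal.mem_sup_left (Ideal.mem_sup_left hk)) ?_
  rw [mul_mem_sup_span_mul_iff hw]
  refine h2 i hi g ?_
  rw [← mul_mem_sup_span_mul_iff hw]
  have : w * (a i * g) = a i * (k + w * g) - a i * k := by ring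
  rw [this]
  exact sub_mem haf (Ideal.mem_sup_left (Ideal.mem_sup_left (Ideal.mul_mem_left _ _ hk)))

end RegularMod

section KrullDimension

variable {R : Type*} [CommRing R]

theorem IsRegularMod.add_ringKrullDim_le {N : ℕ} {a : ℕ → R} (h : IsRegularMod ⊥ N a) {i : ℕ}
    (hi : i ≤ N) : ringKrullDim (R ⧸ initialIdeal a i) + i ≤ ringKrullDim R := by
  induction i with
  | zero =>
    simpa using ringKrullDim_quotient_le (initialIdeal a 0)
  | succ i ih =>
    have hle : initialIdeal a i ≤ initialIdeal a (i + 1) := by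
      rw [initialIdeal_succ]
      exact le_sup_left
    have hreg : Ideal.Quotient.mk (initialIdeal a i) (a i) ∈
        nonZeroDivisors (R ⧸ initialIdeal a i) := by
      rw [mem_nonZeroDivisors_iff_right]
      intro x hx
      obtain ⟨f, rfl⟩ := Ideal.Quotient.mk_surjective x
      rw [← map_mul, Ideal.Quotient.eq_zero_iff_mem] at hx
      rw [Ideal.Quotient.eq_zero_iff_mem]
      have := h i hi f
      rw [bot_sup_eq, mul_comm] at this
      exact this hx
    have := ringKrullDim_succ_le_of_surjective (Ideal.Quotient.factor hle)
      (Ideal.Quotient.factor_surjective hle) hreg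
      (by rw [Ideal.Quotient.factor_mk, Ideal.Quotient.eq_zero_iff_mem]
          exact mem_initialIdeal a (Nat.lt_succ_self i))
    calc ringKrullDim (R ⧸ initialIdeal a (i + 1)) + ((i + 1 : ℕ) : WithBot ℕ∞)
        = (ringKrullDim (R ⧸ initialIdeal a (i + 1)) + 1) + i := by
          push_cast
          rw [add_assoc, add_comm (1 : WithBot ℕ∞)]
      _ ≤ ringKrullDim (R ⧸ initialIdeal a i) + i := by gcongr
      _ ≤ ringKrullDim R := ih (by lia)

/-- Incomparability and going up: an integral extension does not lower the Krull dimension. -/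
theorem ringKrullDim_le_of_isIntegral_of_injective {S : Type*} [CommRing S] [Algebra R S]
    [Algebra.IsIntegral R S] (hinj : Function.Injective (algebraMap R S)) :
    ringKrullDim R ≤ ringKrullDim S := by
  refine iSup_le fun l => ?_
  obtain ⟨Q, -, hQ, hQl⟩ := Ideal.exists_ideal_over_prime_of_isIntegral
    (RelSeries.head l).asIdeal (⊥ : Ideal S) (by
      rw [← RingHom.ker_eq_comap_bot, (RingHom.injective_iff_ker_eq_bot _).1 hinj]
      exact bot_le)
  have : Q.LiesOver (RelSeries.head l).asIdeal := ⟨hQl.symm⟩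
  obtain ⟨L, hL, -⟩ := Ideal.exists_ltSeries_of_hasGoingUp l Q
  rw [← hL]
  exact le_iSup (fun l : LTSeries (PrimeSpectrum S) => (l.length : WithBot ℕ∞)) L

end KrullDimension

section Flat

open RingTheory.Sequence

theorem isWeaklyRegular_iff_isRegularMod {R : Type*} [CommRing R] (N : ℕ) (a : ℕ → R) :
    IsWeaklyRegular R ((List.range N).map a) ↔ IsRegularMod ⊥ N a := by
  have hi (i : ℕ) (hi : i < N) :
      (Ideal.ofList (((List.range N).map a).take i) • ⊤ : Ideal R) = ⊥ ⊔ initialIdeal a i := by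
    rw [← List.map_take, List.take_range, min_eq_left hi.le, bot_sup_eq, initialIdeal,
      Ideal.ofList]
    ext x
    simp
    rfl
  rw [isWeaklyRegular_iff]
  simp only [List.length_map, List.length_range, List.getElem_map, List.getElem_range]
  refine forall_congr' fun i => forall_congr' fun h => ?_
  rw [hi i h, isSMulRegular_quotient_iff_mem_of_smul_mem]
  rfl

theorem IsRegularMod.of_flat {R S : Type*} [CommRing R] [CommRing S] [Algebra R S]
    [Module.Flat R S] {N : ℕ} {a : ℕ → R} (h : IsRegularMod ⊥ N a) :
    IsRegularMod ⊥ N (fun i => algebraMap R S (a i)) := by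
  rw [← isWeaklyRegular_iff_isRegularMod] at h ⊢
  simpa [Function.comp_def] using IsWeaklyRegular.of_flat (S := S) h

end Flat

section Graded

variable {R : Type*} [CommRing R] {F : ℕ → Ideal R}

theorem initialIdeal_mul_le (hmul : ∀ D, F 1 * F D ≤ F (D + 1)) {a a' : ℕ → R} {i : ℕ}
    (h : ∀ l < i, a l - a' l ∈ F 1) (D : ℕ) :
    F (D + 1) ⊔ initialIdeal a i * F D ≤ F (D + 1) ⊔ initialIdeal a' i * F D := by
  refine sup_le le_sup_left ?_
  have h1 : initialIdeal a i ≤ F 1 ⊔ initialIdeal a' i := by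
    rw [initialIdeal, Ideal.span_le]
    rintro _ ⟨l, hl, rfl⟩
    rw [SetLike.mem_coe, ← sub_add_cancel (a l) (a' l)]
    exact add_mem (Ideal.mem_sup_left (h l hl)) (Ideal.mem_sup_right (mem_initialIdeal a' hl))
  refine (Ideal.mul_mono_left h1).trans ?_
  rw [Ideal.sup_mul]
  exact sup_le_sup_right (hmul D) _

/-- The maps `π D` project the filtration `F` onto its `D`-th graded pieces. -/
structure IsGradedProjection (F : ℕ → Ideal R) (b : ℕ → R) (π : ℕ → R →+ R) : Prop where
  proj_mul : ∀ D i f, π D (b i * f) = b i * π D f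
  proj_mem : ∀ D f, π D f ∈ F D
  proj_eq_zero : ∀ D, ∀ f ∈ F (D + 1), π D f = 0
  sub_proj_mem : ∀ D, ∀ f ∈ F D, f - π D f ∈ F (D + 1)

variable {b : ℕ → R} {π : ℕ → R →+ R}

theorem IsGradedProjection.mem_initialIdeal_mul (hπ : IsGradedProjection F b π) (D i : ℕ)
    {f : R} (hf : f ∈ initialIdeal b i) : π D f ∈ initialIdeal b i * F D := by
  induction i generalizing f with
  | zero =>
    rw [initialIdeal_zero] at hf ⊢
    rw [Ideal.mem_bot.1 hf, map_zero]
    exact zero_mem _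
  | succ i ih =>
    rw [initialIdeal_succ] at hf ⊢
    obtain ⟨u, hu, v, hv, rfl⟩ := Submodule.mem_sup.1 hf
    obtain ⟨g, rfl⟩ := Ideal.mem_span_singleton.1 hv
    rw [map_add, hπ.proj_mul, Ideal.sup_mul]
    exact add_mem (Ideal.mem_sup_left (ih hu)) (Ideal.mem_sup_right
      (Ideal.mul_mem_mul (Ideal.mem_span_singleton_self _) (hπ.proj_mem D g)))

theorem IsGradedProjection.isRegularMod (hπ : IsGradedProjection F b π) (h0 : F 0 = ⊤)
    (hF : ∀ D, F (D + 1) ≤ F D) (hmul : ∀ D, F 1 * F D ≤ F (D + 1)) {N : ℕ}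
    (hb : IsRegularMod ⊥ N b) {a : ℕ → R} (hab : ∀ l < N, a l - b l ∈ F 1) (D : ℕ) :
    IsRegularMod (F D) N a := by
  refine IsRegularMod.of_filtration F h0 hF ?_ D
  intro D i hi f hf haf
  have hle := initialIdeal_mul_le hmul (i := i) (fun l hl => hab l (hl.trans hi)) D
  have hge := initialIdeal_mul_le hmul (i := i) (a := b) (a' := a) (fun l hl => by
      rw [← neg_sub]
      exact neg_mem (hab l (hl.trans hi))) D
  have hbf : b i * f ∈ F (D + 1) ⊔ initialIdeal b i * F D := by
    have : b i * f = a i * f - (a i - b i) * f := by ring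
    rw [this]
    exact sub_mem (hle haf) (Ideal.mem_sup_left (hmul D (Ideal.mul_mem_mul (hab i hi) hf)))
  obtain ⟨u, hu, v, hv, huv⟩ := Submodule.mem_sup.1 hbf
  have h1 : b i * π D f ∈ ⊥ ⊔ initialIdeal b i := by
    have hv' : v ∈ initialIdeal b i := Ideal.mul_le_left hv
    have hπv : π D v ∈ initialIdeal b i := Ideal.mul_le_left (hπ.mem_initialIdeal_mul D i hv')
    rwa [← hπ.proj_mul, ← huv, map_add, hπ.proj_eq_zero D u hu, zero_add, bot_sup_eq]
  have h2 := hb i hi _ h1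
  rw [bot_sup_eq] at h2
  have h3 := hπ.mem_initialIdeal_mul D i h2
  have h4 : π D (π D f) = π D f := by
    have := hπ.proj_eq_zero D _ (hπ.sub_proj_mem D f hf)
    rw [map_sub, sub_eq_zero] at this
    exact this.symm
  rw [h4] at h3
  refine hge ?_
  rw [← sub_add_cancel f (π D f)]
  exact add_mem (Ideal.mem_sup_left (hπ.sub_proj_mem D f hf)) (Ideal.mem_sup_right h3)

end Graded

section Filtration

open MvPolynomial

variable {k σ τ : Type*} [CommRing k]

section MapCoeff

variable {A : Type*} [CommRing A] [Algebra k A]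

/-- The coefficientwise application of a linear map to a polynomial. -/
def mapCoeff (h : A →ₗ[k] A) : MvPolynomial τ A →+ MvPolynomial τ A where
  toFun f := ∑ d ∈ f.support, monomial d (h (coeff d f))
  map_zero' := by simp
  map_add' f g := by
    classical
    ext d
    simp only [coeff_add, coeff_sum, coeff_monomial, Finset.sum_ite_eq', mem_support_iff]
    split_ifs <;> simp_all [← map_add]

theorem coeff_mapCoeff (h : A →ₗ[k] A) (f : MvPolynomial τ A) (d : τ →₀ ℕ) :
    coeff d (mapCoeff h f) = h (coeff d f) := by
  classical
  simp only [mapCoeff, AddMonoidHom.coe_mk, ZeroHom.coe_mk, coeff_sum, coeff_monomial,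
    Finset.sum_ite_eq', mem_support_iff]
  split_ifs with hd
  · rfl
  · rw [not_not.1 hd, map_zero]

theorem mapCoeff_map_mul (h : A →ₗ[k] A) (b : MvPolynomial τ k) (f : MvPolynomial τ A) :
    mapCoeff h (map (algebraMap k A) b * f) = map (algebraMap k A) b * mapCoeff h f := by
  classical
  ext d
  simp only [coeff_mapCoeff, coeff_mul, map_sum, coeff_map]
  refine Finset.sum_congr rfl fun x _ => ?_
  rw [← Algebra.smul_def, ← Algebra.smul_def, map_smul]

end MapCoeff

theorem IsRegularMod.map_algebraMap {A : Type*} [CommRing A] [Algebra k A] [Module.Flat k A]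
    {N : ℕ} {b : ℕ → MvPolynomial τ k} (h : IsRegularMod ⊥ N b) :
    IsRegularMod ⊥ N (fun i => map (σ := τ) (algebraMap k A) (b i)) := by
  let : Algebra (MvPolynomial τ k) (MvPolynomial τ A) := MvPolynomial.algebraMvPolynomial
  have : Module.Flat (MvPolynomial τ k) (MvPolynomial τ A) :=
    Module.Flat.isBaseChange k (MvPolynomial τ k) A (MvPolynomial τ A)
      (Algebra.IsPushout.out (R := k) (S := MvPolynomial τ k) (R' := A) (S' := MvPolynomial τ A))
  exact h.of_flat (S := MvPolynomial τ A)

variable (τ) in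
/-- The ideal of polynomials over `A ⊆ k[σ]` whose coefficients have order at least `D`. -/
def orderIdeal (A : Subalgebra k (MvPolynomial σ k)) (D : ℕ) : Ideal (MvPolynomial τ A) :=
  Ideal.map C ((idealOfVars σ k ^ D).comap A.val)

variable {A : Subalgebra k (MvPolynomial σ k)}

theorem mem_orderIdeal {D : ℕ} {f : MvPolynomial τ A} :
    f ∈ orderIdeal τ A D ↔
      ∀ d e, e.degree < D → coeff e ((coeff d f : A) : MvPolynomial σ k) = 0 := by
  simp only [orderIdeal, mem_map_C_iff, Ideal.mem_comap, mem_pow_idealOfVars_iff',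
    Subalgebra.coe_val]

theorem orderIdeal_zero : orderIdeal τ A 0 = ⊤ := by
  rw [Ideal.eq_top_iff_one, mem_orderIdeal]
  simp

theorem orderIdeal_succ_le (D : ℕ) : orderIdeal τ A (D + 1) ≤ orderIdeal τ A D := by
  intro f hf
  rw [mem_orderIdeal] at hf ⊢
  exact fun d e he => hf d e (by lia)

theorem orderIdeal_one_mul_le (D : ℕ) :
    orderIdeal τ A 1 * orderIdeal τ A D ≤ orderIdeal τ A (D + 1) := by
  rw [orderIdeal, orderIdeal, orderIdeal, ← Ideal.map_mul]
  refine Ideal.map_mono ((Ideal.le_comap_mul _).trans ?_)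
  rw [pow_one, pow_succ' _ D]

/-- The homogeneous component as an endomorphism of a graded subalgebra. -/
def componentEnd (hA : ∀ D, ∀ f ∈ A, homogeneousComponent D f ∈ A) (D : ℕ) : A →ₗ[k] A :=
  (homogeneousComponent D).restrict (p := Subalgebra.toSubmodule A)
    (q := Subalgebra.toSubmodule A) (hA D)

theorem coe_componentEnd (hA : ∀ D, ∀ f ∈ A, homogeneousComponent D f ∈ A) (D : ℕ) (f : A) :
    (componentEnd hA D f : MvPolynomial σ k) = homogeneousComponent D (f : MvPolynomial σ k) :=
  rfl

section

variable (hA : ∀ D, ∀ f ∈ A, homogeneousComponent D f ∈ A)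

theorem mapCoeff_componentEnd_mem (D : ℕ) (f : MvPolynomial τ A) :
    mapCoeff (componentEnd hA D) f ∈ orderIdeal τ A D := by
  rw [mem_orderIdeal]
  intro d e he
  rw [coeff_mapCoeff, coe_componentEnd, coeff_homogeneousComponent, if_neg he.ne]

theorem mapCoeff_componentEnd_eq_zero {D : ℕ} {f : MvPolynomial τ A}
    (hf : f ∈ orderIdeal τ A (D + 1)) : mapCoeff (componentEnd hA D) f = 0 := by
  rw [mem_orderIdeal] at hf
  ext d e
  rw [coeff_mapCoeff, coe_componentEnd, coeff_homogeneousComponent]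
  split_ifs with he
  · rw [hf d e (by lia)]
    simp
  · simp

theorem sub_mapCoeff_componentEnd_mem {D : ℕ} {f : MvPolynomial τ A}
    (hf : f ∈ orderIdeal τ A D) :
    f - mapCoeff (componentEnd hA D) f ∈ orderIdeal τ A (D + 1) := by
  rw [mem_orderIdeal] at hf ⊢
  intro d e he
  rw [coeff_sub, coeff_mapCoeff, AddSubgroupClass.coe_sub, coeff_sub, coe_componentEnd,
    coeff_homogeneousComponent]
  split_ifs with h
  · exact sub_self _
  · rw [hf d e (by lia), sub_zero]

theorem isGradedProjection_componentEnd (b : ℕ → MvPolynomial τ k) :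
    IsGradedProjection (orderIdeal τ A) (fun l => map (algebraMap k A) (b l))
      (fun D => mapCoeff (componentEnd hA D)) where
  proj_mul _ _ _ := mapCoeff_map_mul _ _ _
  proj_mem := mapCoeff_componentEnd_mem hA
  proj_eq_zero _ _ := mapCoeff_componentEnd_eq_zero hA
  sub_proj_mem _ _ := sub_mapCoeff_componentEnd_mem hA

end

theorem IsRegularMod.mod_orderIdeal (hA : ∀ D, ∀ f ∈ A, homogeneousComponent D f ∈ A)
    [Module.Flat k A] {N : ℕ} {b : ℕ → MvPolynomial τ k} (hb : IsRegularMod ⊥ N b)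
    {a : ℕ → MvPolynomial τ A}
    (hab : ∀ l < N, a l - map (algebraMap k A) (b l) ∈ orderIdeal τ A 1) (D : ℕ) :
    IsRegularMod (orderIdeal τ A D) N a :=
  (isGradedProjection_componentEnd hA b).isRegularMod orderIdeal_zero orderIdeal_succ_le
    orderIdeal_one_mul_le hb.map_algebraMap hab D

end Filtration

section Shift

open MvPolynomial

variable {k σ τ : Type*} [CommRing k]

/-- The comodule map `k[σ] → k[τ] ⊗ k[σ]` of the translation action along the linear map dual
to `φ : k[σ] → k[τ]`. -/
def shift (φ : MvPolynomial σ k →ₐ[k] MvPolynomial τ k) :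
    MvPolynomial σ k →ₐ[k] MvPolynomial τ (MvPolynomial σ k) :=
  aeval fun i => C (X i) + map (algebraMap k (MvPolynomial σ k)) (φ (X i))

variable {φ : MvPolynomial σ k →ₐ[k] MvPolynomial τ k}

theorem map_constantCoeff_shift (f : MvPolynomial σ k) :
    map constantCoeff (shift φ f) = φ f := by
  have : (map (σ := τ) (constantCoeff (σ := σ) (R := k))).comp (shift φ).toRingHom =
      φ.toRingHom := by
    refine MvPolynomial.ringHom_ext (fun a => ?_) fun i => ?_
    · simp only [shift, AlgHom.toRingHom_eq_coe, RingHom.comp_apply, RingHom.coe_coe,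
        ← algebraMap_eq, AlgHom.commutes]
      simp [IsScalarTower.algebraMap_apply k (MvPolynomial σ k) (MvPolynomial τ (MvPolynomial σ k)),
        algebraMap_eq]
    · simp only [shift, AlgHom.toRingHom_eq_coe, RingHom.comp_apply, RingHom.coe_coe, aeval_X,
        map_add, map_C, constantCoeff_X, map_zero, zero_add, map_map]
      have : (constantCoeff (σ := σ)).comp (algebraMap k (MvPolynomial σ k)) = RingHom.id k := by
        ext a; simp [algebraMap_eq]
      rw [this, map_id]
  exact congr($this f)

theorem constantCoeff_shift (hφ : ∀ i, constantCoeff (φ (X i)) = 0) (f : MvPolynomial σ k) :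
    constantCoeff (shift φ f) = f := by
  have : (constantCoeff (σ := τ)).comp (shift φ).toRingHom =
      RingHom.id (MvPolynomial σ k) := by
    refine MvPolynomial.ringHom_ext (fun a => ?_) fun i => ?_
    · simp only [shift, AlgHom.toRingHom_eq_coe, RingHom.comp_apply, RingHom.coe_coe,
        ← algebraMap_eq, AlgHom.commutes]
      simp [IsScalarTower.algebraMap_apply k (MvPolynomial σ k) (MvPolynomial τ (MvPolynomial σ k)),
        algebraMap_eq]
    · simp [shift, constantCoeff_map, hφ]
  exact congr($this f)

theorem shift_of_mem_span {f : MvPolynomial σ k} (hf : f ∈ Submodule.span k (Set.range X)) :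
    shift φ f = C f + map (algebraMap k (MvPolynomial σ k)) (φ f) := by
  induction hf using Submodule.span_induction with
  | mem f hf => obtain ⟨i, rfl⟩ := hf; simp [shift]
  | zero => simp
  | add f g _ _ hf hg => simp only [map_add, hf, hg]; ring
  | smul a f _ hf =>
    rw [map_smul, hf, smul_add, map_smul φ, smul_eq_C_mul (p := f), smul_eq_C_mul (p := φ f),
      map_mul, map_mul, map_C]
    simp [Algebra.smul_def, IsScalarTower.algebraMap_apply k (MvPolynomial σ k)
      (MvPolynomial τ (MvPolynomial σ k)), algebraMap_eq]

theorem map_shift {g : MvPolynomial σ k →ₐ[k] MvPolynomial σ k}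
    (hg : ∀ i, g (X i) ∈ Submodule.span k (Set.range X)) (hφ : φ.comp g = φ)
    (f : MvPolynomial σ k) : map (g : MvPolynomial σ k →+* MvPolynomial σ k) (shift φ f) =
      shift φ (g f) := by
  have : (map (σ := τ) (g : MvPolynomial σ k →+* MvPolynomial σ k)).comp (shift φ).toRingHom =
      (shift φ).toRingHom.comp g.toRingHom := by
    refine MvPolynomial.ringHom_ext (fun a => ?_) fun i => ?_
    · simp only [shift, AlgHom.toRingHom_eq_coe, RingHom.comp_apply, RingHom.coe_coe,
        ← algebraMap_eq, AlgHom.commutes]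
      rw [IsScalarTower.algebraMap_apply k (MvPolynomial σ k) (MvPolynomial τ (MvPolynomial σ k)),
        algebraMap_eq (MvPolynomial σ k) τ, map_C, RingHom.coe_coe, AlgHom.commutes]
    · have h1 : φ (g (X i)) = φ (X i) := congr($hφ (X i))
      have h2 : (g : MvPolynomial σ k →+* MvPolynomial σ k).comp
          (algebraMap k (MvPolynomial σ k)) = algebraMap k (MvPolynomial σ k) := by
        ext a; simp
      simp only [AlgHom.toRingHom_eq_coe, RingHom.comp_apply, RingHom.coe_coe,
        shift_of_mem_span (hg i), h1]
      simp only [shift, aeval_X, map_add, map_C, map_map, h2, RingHom.coe_coe]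
  exact congr($this f)

variable {A : Subalgebra k (MvPolynomial σ k)}

/-- The comodule map restricted to a subcomodule algebra. -/
theorem exists_shift_lift (hA : ∀ f ∈ A, ∀ d, coeff d (shift φ f) ∈ A) :
    ∃ s : A →+* MvPolynomial τ A, ∀ f, map (A.val : A →+* MvPolynomial σ k) (s f) = shift φ f := by
  have hinj : Function.Injective (map (σ := τ) (A.val : A →+* MvPolynomial σ k)) :=
    map_injective _ Subtype.val_injective
  have hex (f : A) : ∃ a : MvPolynomial τ A,
      map (A.val : A →+* MvPolynomial σ k) a = shift φ f := by
    refine ⟨∑ d ∈ (shift φ f).support, monomial d ⟨coeff d (shift φ f), hA f f.2 d⟩, ?_⟩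
    rw [map_sum]
    conv_rhs => rw [(shift φ (f : MvPolynomial σ k)).as_sum]
    simp [map_monomial]
  choose s hs using hex
  refine ⟨⟨⟨⟨s, hinj ?_⟩, fun f g => hinj ?_⟩, hinj ?_, fun f g => hinj ?_⟩, hs⟩ <;> simp [hs]

theorem mem_sup_initialIdeal_of_isRegularMod [Module.Flat k A]
    (hA : ∀ D, ∀ f ∈ A, homogeneousComponent D f ∈ A)
    (hsh : ∀ f ∈ A, ∀ d, coeff d (shift φ f) ∈ A) (hφ : ∀ i, constantCoeff (φ (X i)) = 0)
    {N : ℕ} {x : ℕ → A} (hx : IsRegularMod ⊥ N (fun l => φ (x l))) {i : ℕ} (hi : i < N) {r : A}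
    (hr : x i * r ∈ initialIdeal x i) (D : ℕ) :
    r ∈ (idealOfVars σ k ^ D).comap A.val ⊔ initialIdeal x i := by
  obtain ⟨s, hs⟩ := exists_shift_lift hsh
  have hab (l) (_ : l < N) :
      s (x l) - map (algebraMap k A) (φ (x l)) ∈ orderIdeal τ A 1 := by
    rw [mem_orderIdeal]
    intro d e he
    obtain rfl : e = 0 := by
      rw [← Finsupp.degree_eq_zero_iff]; lia
    have h1 : ((coeff d (s (x l)) : A) : MvPolynomial σ k) = coeff d (shift φ (x l)) := by
      rw [← hs, coeff_map]; rfl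
    have h2 := congr(coeff d $(map_constantCoeff_shift (φ := φ) (x l : MvPolynomial σ k)))
    rw [coeff_map, ← h1] at h2
    rw [coeff_sub, AddSubgroupClass.coe_sub, coeff_sub, coeff_map, ← h2, sub_eq_zero]
    simp [constantCoeff_eq, algebraMap_eq]
  have key := IsRegularMod.mod_orderIdeal hA hx hab D i hi (s r) (by
    refine Ideal.mem_sup_right ?_
    rw [← map_mul]
    have := Ideal.mem_map_of_mem s hr
    rwa [initialIdeal, Ideal.map_span, ← Set.image_comp] at this)
  have hε (f : A) : constantCoeff (s f) = f := by
    have h1 := constantCoeff_shift hφ (f : MvPolynomial σ k)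
    rw [← hs, constantCoeff_map] at h1
    exact Subtype.ext h1
  have h3 := Ideal.mem_map_of_mem (constantCoeff (σ := τ)) key
  rw [hε, Ideal.map_sup, initialIdeal, Ideal.map_span, ← Set.image_comp] at h3
  have h4 : Ideal.map (constantCoeff (σ := τ)) (orderIdeal τ A D) ≤
      (idealOfVars σ k ^ D).comap A.val := by
    rw [Ideal.map_le_iff_le_comap]
    intro f hf
    rw [Ideal.mem_comap, Ideal.mem_comap, mem_pow_idealOfVars_iff']
    exact fun e he => mem_orderIdeal.1 hf 0 e he
  have h5 : (constantCoeff (σ := τ) ∘ fun l => s (x l)) = x := funext fun l => hε (x l)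
  rw [h5] at h3
  exact (sup_le_sup_right h4 (initialIdeal x i) :) h3

theorem componentEnd_mem_initialIdeal (hA : ∀ D, ∀ f ∈ A, homogeneousComponent D f ∈ A)
    {x : ℕ → A} {i : ℕ} {d : ℕ → ℕ}
    (hd : ∀ l < i, (x l : MvPolynomial σ k).IsHomogeneous (d l)) {f : A}
    (hf : f ∈ initialIdeal x i) (D : ℕ) : componentEnd hA D f ∈ initialIdeal x i := by
  classical
  induction i generalizing f with
  | zero =>
    rw [initialIdeal_zero] at hf ⊢
    rw [Ideal.mem_bot.1 hf, map_zero]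
    exact zero_mem _
  | succ i ih =>
    rw [initialIdeal_succ] at hf ⊢
    obtain ⟨u, hu, v, hv, rfl⟩ := Submodule.mem_sup.1 hf
    obtain ⟨g, rfl⟩ := Ideal.mem_span_singleton.1 hv
    rw [map_add]
    refine add_mem (Ideal.mem_sup_left (ih (fun l hl => hd l (hl.trans i.lt_succ_self)) hu))
      (Ideal.mem_sup_right ?_)
    have hg : g = ∑ e ∈ Finset.range ((g : MvPolynomial σ k).totalDegree + 1),
        componentEnd hA e g := by
      apply Subtype.ext
      rw [AddSubmonoidClass.coe_finsetSum]
      simp only [coe_componentEnd, sum_homogeneousComponent]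
    rw [hg, Finset.mul_sum, map_sum]
    refine sum_mem fun e _ => ?_
    have h : componentEnd hA D (x i * componentEnd hA e g) =
        if D = d i + e then x i * componentEnd hA e g else 0 := by
      apply Subtype.ext
      rw [coe_componentEnd, MulMemClass.coe_mul, coe_componentEnd,
        homogeneousComponent_of_mem ((hd i i.lt_succ_self).mul
          (homogeneousComponent_isHomogeneous e _))]
      split_ifs <;> rfl
    rw [h]
    split_ifs
    · exact Ideal.mul_mem_right _ _ (Ideal.mem_span_singleton_self _)
    · exact zero_mem _

theorem isRegularMod_of_shift [Module.Flat k A]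
    (hA : ∀ D, ∀ f ∈ A, homogeneousComponent D f ∈ A)
    (hsh : ∀ f ∈ A, ∀ d, coeff d (shift φ f) ∈ A) (hφ : ∀ i, constantCoeff (φ (X i)) = 0)
    {N : ℕ} {x : ℕ → A} {d : ℕ → ℕ}
    (hd : ∀ l < N, (x l : MvPolynomial σ k).IsHomogeneous (d l))
    (hx : IsRegularMod ⊥ N (fun l => φ (x l))) : IsRegularMod ⊥ N x := by
  intro i hi r hr
  rw [bot_sup_eq] at hr ⊢
  obtain ⟨t, ht, j, hj, htj⟩ := Submodule.mem_sup.1 (mem_sup_initialIdeal_of_isRegularMod hA hsh hφ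
    hx hi hr ((r : MvPolynomial σ k).totalDegree + 1))
  have hr' : r = ∑ e ∈ Finset.range ((r : MvPolynomial σ k).totalDegree + 1),
      componentEnd hA e j := by
    conv_lhs => rw [← Subtype.coe_inj.1 (show ((∑ e ∈ Finset.range
      ((r : MvPolynomial σ k).totalDegree + 1), componentEnd hA e r : A) : MvPolynomial σ k) = r by
        rw [AddSubmonoidClass.coe_finsetSum]
        simp only [coe_componentEnd, sum_homogeneousComponent])]
    refine Finset.sum_congr rfl fun e he => ?_
    rw [← htj, map_add]
    convert zero_add _
    apply Subtype.ext
    rw [Ideal.mem_comap, mem_pow_idealOfVars_iff'] at ht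
    ext m
    rw [coe_componentEnd, coeff_homogeneousComponent]
    split_ifs with h
    · rw [← h] at he
      simpa using ht m (by simpa using he)
    · simp
  rw [hr']
  exact sum_mem fun e _ => componentEnd_mem_initialIdeal hA (fun l hl => hd l (hl.trans hi)) hj e

end Shift

section RegSeq

variable {R : Type*} [CommRing R]

theorem seqSubmodule_eq_initialIdeal {N : ℕ} {y : Fin N → R} {a : ℕ → R}
    (h : ∀ i : Fin N, a i = y i) {j : ℕ} (hj : j ≤ N) : seqSubmodule R y j = initialIdeal a j := by
  refine le_antisymm (Submodule.span_le.2 ?_) (Submodule.span_le.2 ?_)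
  · rintro _ ⟨l, hl, x, rfl⟩
    rw [smul_eq_mul, ← h l]
    exact Ideal.mul_mem_right _ _ (mem_initialIdeal a hl)
  · rintro _ ⟨l, hl, rfl⟩
    exact Submodule.subset_span ⟨⟨l, lt_of_lt_of_le hl hj⟩, hl, 1, by simp [← h]⟩

theorem isRegSeq_iff_isRegularMod {N : ℕ} {y : Fin N → R} {a : ℕ → R}
    (h : ∀ i : Fin N, a i = y i) :
    IsRegSeq R y ↔ IsRegularMod ⊥ N a ∧ initialIdeal a N ≠ ⊤ := by
  rw [IsRegSeq, seqSubmodule_eq_initialIdeal h le_rfl]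
  refine and_congr_left fun _ => ⟨fun H i hi f hf => ?_, fun H i f hf => ?_⟩
  · rw [bot_sup_eq] at hf ⊢
    have := H ⟨i, hi⟩ f
    rw [seqSubmodule_eq_initialIdeal h hi.le, smul_eq_mul, ← h] at this
    exact this hf
  · rw [seqSubmodule_eq_initialIdeal h i.2.le, smul_eq_mul, ← h] at hf
    rw [seqSubmodule_eq_initialIdeal h i.2.le]
    have := H i i.2 f
    rw [bot_sup_eq] at this
    exact this hf

theorem initialIdeal_ne_top_of_map_eq_zero {T : Type*} [CommRing T] [Nontrivial T] (f : R →+* T)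
    {a : ℕ → R} {N : ℕ} (h : ∀ l < N, f (a l) = 0) : initialIdeal a N ≠ ⊤ := by
  refine ne_top_of_le_ne_top (RingHom.ker_ne_top f) (Ideal.span_le.2 ?_)
  rintro _ ⟨l, hl, rfl⟩
  exact h l hl

end RegSeq

section Transfer

variable {A B : Type*} [CommRing A] [CommRing B]

theorem map_mem_initialIdeal (ι : B →+* A) {x : ℕ → B} {i : ℕ} {f : B}
    (hf : f ∈ initialIdeal x i) : ι f ∈ initialIdeal (fun l => ι (x l)) i := by
  have := Ideal.mem_map_of_mem ι hf
  rwa [initialIdeal, Ideal.map_span, ← Set.image_comp] at this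

theorem transfer_mem_initialIdeal (ι : B →+* A) (tr : A →+ B)
    (htr : ∀ b a, tr (ι b * a) = b * tr a) {x : ℕ → B} {i : ℕ} {f : A}
    (hf : f ∈ initialIdeal (fun l => ι (x l)) i) : tr f ∈ initialIdeal x i := by
  induction i generalizing f with
  | zero =>
    rw [initialIdeal_zero] at hf ⊢
    rw [Ideal.mem_bot.1 hf, map_zero]
    exact zero_mem _
  | succ i ih =>
    rw [initialIdeal_succ] at hf ⊢
    obtain ⟨u, hu, v, hv, rfl⟩ := Submodule.mem_sup.1 hf
    obtain ⟨g, rfl⟩ := Ideal.mem_span_singleton.1 hv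
    rw [map_add, htr]
    exact add_mem (Ideal.mem_sup_left (ih hu))
      (Ideal.mem_sup_right (Ideal.mul_mem_right _ _ (Ideal.mem_span_singleton_self _)))

/-- Weak regularity descends along a ring extension with a transfer. -/
theorem IsRegularMod.of_transfer (ι : B →+* A) (tr : A →+ B)
    (htr : ∀ b a, tr (ι b * a) = b * tr a) (hu : IsUnit (tr 1)) {x : ℕ → B} {N : ℕ}
    (h : IsRegularMod ⊥ N (fun l => ι (x l))) : IsRegularMod ⊥ N x := by
  intro i hi f hf
  rw [bot_sup_eq] at hf ⊢
  have h1 := h i hi (ι f)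
  rw [bot_sup_eq, ← map_mul] at h1
  have h2 := transfer_mem_initialIdeal ι tr htr (h1 (map_mem_initialIdeal ι hf))
  rw [← mul_one (ι f), htr] at h2
  exact (Ideal.mul_unit_mem_iff_mem _ hu).1 h2

theorem IsRegularMod.of_subalgebra_transfer {k S : Type*} [CommRing k] [CommRing S] [Algebra k S]
    {B A : Subalgebra k S} (hBA : B ≤ A) (tr : S → S) (hmem : ∀ a ∈ A, tr a ∈ B)
    (hadd : ∀ a b, tr (a + b) = tr a + tr b) (hmul : ∀ b ∈ B, ∀ a, tr (b * a) = b * tr a) {u : k}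
    (hu : IsUnit u) (htr : tr 1 = algebraMap k S u) {x : ℕ → B} {y : ℕ → A}
    (hxy : ∀ l, (y l : S) = x l) {N : ℕ} (h : IsRegularMod ⊥ N y) : IsRegularMod ⊥ N x := by
  obtain rfl : y = fun l => (Subalgebra.inclusion hBA).toRingHom (x l) :=
    funext fun l => Subtype.ext (hxy l)
  refine IsRegularMod.of_transfer (Subalgebra.inclusion hBA).toRingHom
    (AddMonoidHom.mk' (fun f => ⟨tr f, hmem f f.2⟩) fun f g => Subtype.ext (hadd f g))
    (fun b a => Subtype.ext (hmul b b.2 a)) ?_ h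
  have : (⟨tr (1 : A), hmem _ (1 : A).2⟩ : B) = algebraMap k B u := Subtype.ext htr
  simp only [AddMonoidHom.mk'_apply, this]
  exact hu.map _

end Transfer

section Action

variable {Γ : Type*} {e q : ℕ} [Fact q.Prime] [Group Γ]
  {σ : Γ →* (MvPolynomial (Fin e) (ZMod q) ≃ₐ[ZMod q] MvPolynomial (Fin e) (ZMod q))}

theorem mem_fixedSub {K : Subgroup Γ} {f : MvPolynomial (Fin e) (ZMod q)} :
    f ∈ fixedSub σ K ↔ ∀ g ∈ K, σ g f = f := by
  simp [fixedSub, Algebra.mem_iInf, AlgHom.mem_equalizer]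

theorem fixedSub_le_of_le {H K : Subgroup Γ} (h : H ≤ K) : fixedSub σ K ≤ fixedSub σ H :=
  fun _ hf => mem_fixedSub.2 fun g hg => mem_fixedSub.1 hf g (h hg)

/-- The transfer from `H`-invariants to invariants. -/
def cosetSum (σ : Γ →* (MvPolynomial (Fin e) (ZMod q) ≃ₐ[ZMod q] MvPolynomial (Fin e) (ZMod q)))
    (H : Subgroup Γ) [Fintype (Γ ⧸ H)] (f : MvPolynomial (Fin e) (ZMod q)) :
    MvPolynomial (Fin e) (ZMod q) :=
  ∑ c : Γ ⧸ H, σ c.out f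

variable {H : Subgroup Γ} [Fintype (Γ ⧸ H)]

theorem cosetSum_mem {f : MvPolynomial (Fin e) (ZMod q)} (hf : f ∈ fixedSub σ H) :
    cosetSum σ H f ∈ fixedSub σ ⊤ := by
  have hout (g : Γ) : σ (g : Γ ⧸ H).out f = σ g f := by
    obtain ⟨h, hh⟩ := QuotientGroup.mk_out_eq_mul H g
    rw [hh, map_mul, AlgEquiv.mul_apply, mem_fixedSub.1 hf h h.2]
  refine mem_fixedSub.2 fun g _ => ?_
  rw [cosetSum, map_sum, ← Equiv.sum_comp (MulAction.toPerm g) fun c : Γ ⧸ H => σ c.out f]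
  refine Finset.sum_congr rfl fun c _ => ?_
  rw [← AlgEquiv.mul_apply, ← map_mul, ← hout, MulAction.toPerm_apply]
  congr 3
  conv_rhs => rw [← QuotientGroup.out_eq' c]
  rfl

theorem cosetSum_one : cosetSum σ H 1 = (Fintype.card (Γ ⧸ H) : MvPolynomial (Fin e) (ZMod q)) := by
  simp [cosetSum]

theorem cosetSum_add (f g : MvPolynomial (Fin e) (ZMod q)) :
    cosetSum σ H (f + g) = cosetSum σ H f + cosetSum σ H g := by
  simp [cosetSum, Finset.sum_add_distrib]

theorem cosetSum_mul {f : MvPolynomial (Fin e) (ZMod q)} (hf : f ∈ fixedSub σ ⊤)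
    (g : MvPolynomial (Fin e) (ZMod q)) : cosetSum σ H (f * g) = f * cosetSum σ H g := by
  rw [cosetSum, cosetSum, Finset.mul_sum]
  refine Finset.sum_congr rfl fun c _ => ?_
  rw [map_mul, mem_fixedSub.1 hf _ (Subgroup.mem_top _)]

theorem isHomogeneous_algHom {k ι : Type*} [Field k] {g : MvPolynomial ι k →ₐ[k] MvPolynomial ι k}
    (hg : ∀ i, (g (X i)).IsHomogeneous 1) {f : MvPolynomial ι k} {d : ℕ} (hf : f.IsHomogeneous d) :
    (g f).IsHomogeneous d := by
  have := hf.aeval (fun i => g (X i)) hg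
  rw [one_mul] at this
  rwa [aeval_unique g]

theorem homogeneousComponent_algHom {k ι : Type*} [Field k]
    {g : MvPolynomial ι k →ₐ[k] MvPolynomial ι k}
    (hg : ∀ i, (g (X i)).IsHomogeneous 1) (D : ℕ) (f : MvPolynomial ι k) :
    homogeneousComponent D (g f) = g (homogeneousComponent D f) := by
  have h (i : ℕ) : (g (homogeneousComponent i f)).IsHomogeneous i :=
    isHomogeneous_algHom hg (homogeneousComponent_isHomogeneous i f)
  conv_lhs => rw [← sum_homogeneousComponent f, map_sum, map_sum]
  rw [Finset.sum_congr rfl fun i _ => homogeneousComponent_of_mem (h i), Finset.sum_ite_eq]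
  split_ifs with hD
  · rfl
  · rw [homogeneousComponent_eq_zero _ _ (by simpa using hD), map_zero]

end Action

section Duflot

theorem flat_zmod {q : ℕ} [Fact q.Prime] (M : Type*) [AddCommGroup M] [Module (ZMod q) M] :
    Module.Flat (ZMod q) M :=
  inferInstance

variable {e q : ℕ} [Fact q.Prime] {Γ : Type*} [Group Γ]
  {ρ : Representation (ZMod q) Γ (Fin e → ZMod q)}
  {σ : Γ →* (MvPolynomial (Fin e) (ZMod q) ≃ₐ[ZMod q] MvPolynomial (Fin e) (ZMod q))}

theorem InducedAction.isHomogeneous (hσ : InducedAction ρ σ) (g : Γ) (i : Fin e) :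
    (σ g (X i)).IsHomogeneous 1 := by
  rw [hσ g i]
  exact IsHomogeneous.sum _ _ _ fun j _ => by
    simpa using (isHomogeneous_C (Fin e) _).mul (isHomogeneous_X (ZMod q) j)

theorem InducedAction.homogeneousComponent_mem (hσ : InducedAction ρ σ) (K : Subgroup Γ) (D : ℕ)
    {f : MvPolynomial (Fin e) (ZMod q)} (hf : f ∈ fixedSub σ K) :
    homogeneousComponent D f ∈ fixedSub σ K := by
  refine mem_fixedSub.2 fun g hg => ?_
  have := homogeneousComponent_algHom (g := (σ g : _ →ₐ[ZMod q] _))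
    (hσ.isHomogeneous g) D f
  rw [AlgEquiv.coe_toAlgHom, mem_fixedSub.1 hf g hg] at this
  exact this.symm

/-- The restriction of polynomial functions along a linear map. -/
def restrictAlong {m : ℕ} (c : (Fin m → ZMod q) →ₗ[ZMod q] (Fin e → ZMod q)) :
    MvPolynomial (Fin e) (ZMod q) →ₐ[ZMod q] MvPolynomial (Fin m) (ZMod q) :=
  aeval fun i => ∑ j : Fin m, C (c (Pi.single j (1 : ZMod q)) i) * X j

variable {m : ℕ} {c : (Fin m → ZMod q) →ₗ[ZMod q] (Fin e → ZMod q)}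

theorem restrictAlong_X (i : Fin e) :
    restrictAlong c (X i) = ∑ j : Fin m, C (c (Pi.single j (1 : ZMod q)) i) * X j :=
  aeval_X _ _

theorem InducedAction.restrictAlong_comp (hσ : InducedAction ρ σ) {g : Γ}
    (hg : ∀ v, ρ g (c v) = c v) :
    (restrictAlong c).comp (σ g : _ →ₐ[ZMod q] _) = restrictAlong c := by
  have hg' (v) : ρ g⁻¹ (c v) = c v := by
    conv_lhs => rw [← hg v]
    simp
  refine algHom_ext fun i => ?_
  rw [AlgHom.comp_apply, AlgEquiv.coe_toAlgHom, hσ g i, map_sum]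
  simp only [map_mul, algHom_C, restrictAlong_X, algebraMap_eq, Finset.mul_sum]
  rw [Finset.sum_comm]
  refine Finset.sum_congr rfl fun l _ => ?_
  simp_rw [← mul_assoc, ← C_mul]
  rw [← Finset.sum_mul, ← map_sum]
  congr 2
  conv_rhs => rw [← hg', LinearMap.pi_apply_eq_sum_univ (ρ g⁻¹) (c (Pi.single l 1))]
  rw [Finset.sum_apply]
  refine Finset.sum_congr rfl fun j _ => ?_
  have : (Pi.single j 1 : Fin e → ZMod q) = fun j' => if j = j' then 1 else 0 := by
    ext j'
    simp [Pi.single_apply, eq_comm]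
  rw [Pi.smul_apply, smul_eq_mul, mul_comm, this]

theorem InducedAction.coeff_shift_mem (hσ : InducedAction ρ σ) {K : Subgroup Γ}
    (hK : ∀ g ∈ K, ∀ v, ρ g (c v) = c v) {f : MvPolynomial (Fin e) (ZMod q)}
    (hf : f ∈ fixedSub σ K) (d : Fin m →₀ ℕ) :
    coeff d (shift (restrictAlong c) f) ∈ fixedSub σ K := by
  refine mem_fixedSub.2 fun g hg => ?_
  have := map_shift (g := (σ g : _ →ₐ[ZMod q] _)) (fun i => by
    rw [← homogeneousSubmodule_one_eq_span_X]
    exact hσ.isHomogeneous g i) (hσ.restrictAlong_comp (hK g hg)) f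
  rw [AlgEquiv.coe_toAlgHom, mem_fixedSub.1 hf g hg] at this
  have := congr(coeff d $this)
  rwa [coeff_map] at this

theorem flat_fixedSub (K : Subgroup Γ) : Module.Flat (ZMod q) (fixedSub σ K) :=
  flat_zmod _

theorem InducedAction.isRegularMod_of_fixed (hσ : InducedAction ρ σ) {K : Subgroup Γ}
    (hK : ∀ g ∈ K, ∀ v, ρ g (c v) = c v) {N : ℕ} {x : ℕ → fixedSub σ K} {d : ℕ → ℕ}
    (hd : ∀ l < N, (x l : MvPolynomial (Fin e) (ZMod q)).IsHomogeneous (d l))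
    (hx : IsRegularMod ⊥ N (fun l => restrictAlong c (x l))) : IsRegularMod ⊥ N x := by
  have := flat_fixedSub (σ := σ) K
  have h0 (i) : constantCoeff (restrictAlong c (X i)) = 0 := by
    simp [restrictAlong_X]
  have h1 (D) (f) (hf : f ∈ fixedSub σ K) := hσ.homogeneousComponent_mem K D hf
  have h2 (f) (hf : f ∈ fixedSub σ K) := hσ.coeff_shift_mem hK hf
  exact isRegularMod_of_shift h1 h2 h0 hd hx

/-- **Duflot's theorem**: regularity of a sequence of invariants can be tested after restriction
to the fixed points of a Sylow subgroup. -/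
theorem InducedAction.isRegularMod [Fintype Γ] (hσ : InducedAction ρ σ) (P : Sylow q Γ)
    (hP : ∀ g ∈ (P : Subgroup Γ), ∀ v, ρ g (c v) = c v) {N : ℕ} {x : ℕ → fixedSub σ ⊤} {d : ℕ → ℕ}
    (hd : ∀ l < N, (x l : MvPolynomial (Fin e) (ZMod q)).IsHomogeneous (d l))
    (hx : IsRegularMod ⊥ N (fun l => restrictAlong c (x l))) : IsRegularMod ⊥ N x := by
  classical
  have hle : fixedSub σ ⊤ ≤ fixedSub σ (P : Subgroup Γ) := fixedSub_le_of_le le_top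
  have hy : IsRegularMod ⊥ N
      (fun l => (⟨x l, hle (x l).2⟩ : fixedSub σ (P : Subgroup Γ))) :=
    hσ.isRegularMod_of_fixed hP hd hx
  have hu : IsUnit (Fintype.card (Γ ⧸ (P : Subgroup Γ)) : ZMod q) := by
    rw [isUnit_iff_ne_zero, Ne, ZMod.natCast_eq_zero_iff, ← Nat.card_eq_fintype_card]
    exact P.not_dvd_index
  exact hy.of_subalgebra_transfer hle (cosetSum σ P) (fun a ha => cosetSum_mem ha) cosetSum_add
    (fun b hb => cosetSum_mul hb) hu (by rw [cosetSum_one, map_natCast]) fun l => rfl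

end Duflot

section RootPoly

variable {κ B : Type*} [Fintype κ] [CommRing B]

/-- The polynomial whose roots are the values of `ψ`; its coefficients are Dickson invariants. -/
def rootPoly (ψ : κ → B) : Polynomial B :=
  ∏ u : κ, (Polynomial.X - Polynomial.C (ψ u))

theorem map_rootPoly {B' : Type*} [CommRing B'] (f : B →+* B') (ψ : κ → B) :
    (rootPoly ψ).map f = rootPoly (f ∘ ψ) := by
  simp [rootPoly, Polynomial.map_prod]

end RootPoly

section Dickson

variable {q : ℕ} [Fact q.Prime] {E B : Type*} [AddCommGroup E] [Module (ZMod q) E]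
  [CommRing B] [Algebra (ZMod q) B]

/-- The ideal generated by the image of a subspace. -/
def imageIdeal (ψ : E →ₗ[ZMod q] B) (U : Submodule (ZMod q) E) : Ideal B :=
  Ideal.span (ψ '' U)

theorem mem_imageIdeal (ψ : E →ₗ[ZMod q] B) {U : Submodule (ZMod q) E} {u : E} (hu : u ∈ U) :
    ψ u ∈ imageIdeal ψ U :=
  Ideal.subset_span ⟨u, hu, rfl⟩

theorem imageIdeal_sup_span_singleton (ψ : E →ₗ[ZMod q] B) (U : Submodule (ZMod q) E) (u : E) :
    imageIdeal ψ (U ⊔ Submodule.span (ZMod q) {u}) = imageIdeal ψ U ⊔ Ideal.span {ψ u} := by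
  refine le_antisymm (Ideal.span_le.2 ?_) (sup_le (Ideal.span_mono (Set.image_mono ?_)) ?_)
  · rintro _ ⟨v, hv, rfl⟩
    obtain ⟨w, hw, z, hz, rfl⟩ := Submodule.mem_sup.1 hv
    obtain ⟨a, rfl⟩ := Submodule.mem_span_singleton.1 hz
    rw [SetLike.mem_coe, map_add, map_smul, Algebra.smul_def]
    exact add_mem (Ideal.mem_sup_left (mem_imageIdeal ψ hw))
      (Ideal.mem_sup_right (Ideal.mul_mem_left _ _ (Ideal.mem_span_singleton_self _)))
  · exact fun v hv => Submodule.mem_sup_left hv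
  · rw [Ideal.span_singleton_le_iff_mem]
    exact mem_imageIdeal ψ (Submodule.mem_sup_right (Submodule.mem_span_singleton_self u))

theorem IsRegularMod.sup_span_prod {I : Ideal B} (hI : I.IsPrime) {N : ℕ} {a : ℕ → B}
    {ι : Type*} {f : ι → B} (s : Finset ι) (hf : ∀ i ∈ s, f i ∉ I)
    (h : ∀ i ∈ s, IsRegularMod (I ⊔ Ideal.span {f i}) N a) :
    IsRegularMod (I ⊔ Ideal.span {∏ i ∈ s, f i}) N a := by
  classical
  induction s using Finset.induction_on with
  | empty => simpa using isRegularMod_top N a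
  | insert i s hi ih =>
    rw [Finset.prod_insert hi]
    exact IsRegularMod.sup_mul
      (fun g hg => (hI.mem_or_mem hg).resolve_left (hf i (Finset.mem_insert_self _ _)))
      (h i (Finset.mem_insert_self _ _))
      (ih (fun j hj => hf j (Finset.mem_insert_of_mem hj))
        fun j hj => h j (Finset.mem_insert_of_mem hj))

variable [Fintype E]

open Classical in
theorem mk_coeff_rootPoly (ψ : E →ₗ[ZMod q] B) (U : Submodule (ZMod q) E) :
    Ideal.Quotient.mk (imageIdeal ψ U) ((rootPoly ψ).coeff (Nat.card U)) =
      (-1) ^ (Finset.univ.filter (· ∉ U)).card *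
        Ideal.Quotient.mk (imageIdeal ψ U) (∏ u ∈ Finset.univ.filter (· ∉ U), ψ u) := by
  have h1 : (rootPoly ψ).map (Ideal.Quotient.mk (imageIdeal ψ U)) =
      (∏ u ∈ Finset.univ.filter (· ∉ U),
        (Polynomial.X - Polynomial.C (Ideal.Quotient.mk (imageIdeal ψ U) (ψ u)))) *
        Polynomial.X ^ Nat.card U := by
    rw [map_rootPoly, rootPoly, ← Finset.prod_filter_not_mul_prod_filter _ (· ∈ U)]
    congr 1
    have : Nat.card U = (Finset.univ.filter (· ∈ U)).card := by
      rw [Nat.card_eq_fintype_card, Fintype.card_subtype]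
    rw [this, ← Finset.prod_const]
    refine Finset.prod_congr rfl fun u hu => ?_
    rw [Function.comp_apply,
      Ideal.Quotient.eq_zero_iff_mem.2 (mem_imageIdeal ψ (Finset.mem_filter.1 hu).2)]
    simp
  have h2 := congr(Polynomial.coeff $h1 (Nat.card U))
  rw [Polynomial.coeff_map, Polynomial.coeff_mul_X_pow', if_pos le_rfl, Nat.sub_self,
    Polynomial.coeff_zero_prod] at h2
  rw [h2, map_prod]
  simp [Finset.prod_neg]

open Classical in
theorem imageIdeal_sup_span_coeff_rootPoly (ψ : E →ₗ[ZMod q] B) (U : Submodule (ZMod q) E) :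
    imageIdeal ψ U ⊔ Ideal.span {(rootPoly ψ).coeff (Nat.card U)} =
      imageIdeal ψ U ⊔ Ideal.span {∏ u ∈ Finset.univ.filter (· ∉ U), ψ u} := by
  have h := mk_coeff_rootPoly ψ U
  set J := imageIdeal ψ U
  set c := (rootPoly ψ).coeff (Nat.card U)
  set P := ∏ u ∈ Finset.univ.filter (· ∉ U), ψ u
  set r := (Finset.univ.filter (· ∉ U)).card
  have h1 : c - (-1) ^ r * P ∈ J := by
    rw [← Ideal.Quotient.eq_zero_iff_mem, map_sub, h]
    simp
  have h2 : (-1 : B) ^ r * (-1) ^ r = 1 := by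
    rw [← mul_pow]; simp
  refine le_antisymm (sup_le le_sup_left ?_) (sup_le le_sup_left ?_) <;>
    rw [Ideal.span_singleton_le_iff_mem]
  · rw [← sub_add_cancel c ((-1) ^ r * P)]
    exact add_mem (Ideal.mem_sup_left h1)
      (Ideal.mem_sup_right (Ideal.mul_mem_left _ _ (Ideal.mem_span_singleton_self _)))
  · have : P = (-1) ^ r * c - (-1) ^ r * (c - (-1) ^ r * P) := by
      linear_combination -P * h2
    rw [this]
    exact sub_mem (Ideal.mem_sup_right (Ideal.mul_mem_left _ _ (Ideal.mem_span_singleton_self _)))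
      (Ideal.mem_sup_left (Ideal.mul_mem_left _ _ h1))

/-- The Dickson invariants of the lowest indices form a regular sequence. -/
theorem isRegularMod_coeff_rootPoly (ψ : E →ₗ[ZMod q] B)
    (hprime : ∀ U, (imageIdeal ψ U).IsPrime)
    (hmem : ∀ U u, LinearMap.ker ψ ≤ U → ψ u ∈ imageIdeal ψ U → u ∈ U) (r : ℕ)
    (U : Submodule (ZMod q) E) (hU : LinearMap.ker ψ ≤ U)
    (hr : Module.finrank (ZMod q) U + r = Module.finrank (ZMod q) E) :
    IsRegularMod (imageIdeal ψ U) r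
      (fun j => (rootPoly ψ).coeff (q ^ (Module.finrank (ZMod q) U + j))) := by
  classical
  induction r generalizing U with
  | zero => exact fun i hi => absurd hi i.not_lt_zero
  | succ r ih =>
    have hcard : q ^ (Module.finrank (ZMod q) U + 0) = Nat.card U := by
      rw [Module.natCard_eq_pow_finrank (K := ZMod q), Nat.card_zmod, add_zero]
    have hout : ∀ u ∈ Finset.univ.filter (· ∉ U), ψ u ∉ imageIdeal ψ U := fun u hu hu' =>
      (Finset.mem_filter.1 hu).2 (hmem U u hU hu')
    refine IsRegularMod.cons (fun f hf => ((hprime U).mem_or_mem hf).resolve_left fun h => ?_) ?_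
    · rw [hcard, ← Ideal.Quotient.eq_zero_iff_mem, mk_coeff_rootPoly] at h
      have h' : Ideal.Quotient.mk (imageIdeal ψ U) (∏ u ∈ Finset.univ.filter (· ∉ U), ψ u) = 0 := by
        exact (isUnit_one.neg.pow _).mul_right_eq_zero.1 h
      rw [Ideal.Quotient.eq_zero_iff_mem, (hprime U).prod_mem_iff] at h'
      obtain ⟨u, hu, hu'⟩ := h'
      exact hout u hu hu'
    · rw [hcard, imageIdeal_sup_span_coeff_rootPoly]
      refine IsRegularMod.sup_span_prod (hprime U) _ hout fun u hu => ?_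
      rw [← imageIdeal_sup_span_singleton]
      have hdim := Submodule.finrank_sup_span_singleton (K := ZMod q) (Finset.mem_filter.1 hu).2
      have := ih (U ⊔ Submodule.span (ZMod q) {u}) (hU.trans le_sup_left) (by lia)
      simp only [hdim] at this
      simpa only [add_assoc, add_comm 1] using this

theorem isHomogeneous_coeff_prod {k ι κ : Type*} [CommRing k] [Nontrivial k]
    (f : κ → MvPolynomial ι k) (hf : ∀ u, (f u).IsHomogeneous 1) (s : Finset κ) {j d : ℕ}
    (hjd : j + d = s.card) :
    ((∏ u ∈ s, (Polynomial.X - Polynomial.C (f u))).coeff j).IsHomogeneous d := by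
  classical
  induction s using Finset.induction_on generalizing j d with
  | empty =>
    obtain ⟨rfl, rfl⟩ : j = 0 ∧ d = 0 := by simpa using hjd
    simpa using isHomogeneous_one ι k
  | insert u s hu ih =>
    rw [Finset.card_insert_of_notMem hu] at hjd
    have hmul {j d : ℕ} (h : j + d = s.card + 1) :
        (f u * (∏ u ∈ s, (Polynomial.X - Polynomial.C (f u))).coeff j).IsHomogeneous d := by
      rcases d with - | d
      · rw [Polynomial.coeff_eq_zero_of_natDegree_lt, mul_zero]
        · exact isHomogeneous_zero _ _ _
        · rw [Polynomial.natDegree_finsetProd_X_sub_C_eq_card]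
          lia
      · rw [add_comm d 1]
        exact (hf u).mul (ih (by lia))
    rw [Finset.prod_insert hu, sub_mul, Polynomial.coeff_sub, Polynomial.coeff_C_mul]
    refine IsHomogeneous.sub ?_ (hmul hjd)
    rcases j with - | j
    · rw [Polynomial.mul_coeff_zero, Polynomial.coeff_X_zero, zero_mul]
      exact isHomogeneous_zero _ _ _
    · rw [Polynomial.coeff_X_mul]
      exact ih (by lia)

end Dickson

section LinearForms

variable {q : ℕ} [Fact q.Prime]

/-- The linear form on affine space corresponding to a functional. -/
def linearForm (m : ℕ) :
    Module.Dual (ZMod q) (Fin m → ZMod q) →ₗ[ZMod q] MvPolynomial (Fin m) (ZMod q) where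
  toFun f := ∑ i, C (f (Pi.single i 1)) * X i
  map_add' f g := by simp [add_mul, Finset.sum_add_distrib]
  map_smul' a f := by simp [smul_eq_C_mul, Finset.mul_sum, mul_assoc]

theorem linearForm_apply {m : ℕ} (f : Module.Dual (ZMod q) (Fin m → ZMod q)) :
    linearForm m f = ∑ i, C (f (Pi.single i 1)) * X i :=
  rfl

theorem linearForm_isHomogeneous {m : ℕ} (f : Module.Dual (ZMod q) (Fin m → ZMod q)) :
    (linearForm m f).IsHomogeneous 1 :=
  IsHomogeneous.sum _ _ _ fun i _ => by
    simpa using (isHomogeneous_C (Fin m) _).mul (isHomogeneous_X (ZMod q) i)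

theorem linearForm_proj {m : ℕ} (i : Fin m) :
    linearForm m (LinearMap.proj i : Module.Dual (ZMod q) (Fin m → ZMod q)) = X i := by
  simp [linearForm_apply, Pi.single_apply]

theorem linearForm_injective (m : ℕ) : Function.Injective (linearForm (q := q) m) := by
  intro f g h
  refine LinearMap.pi_ext' fun i => LinearMap.ext_ring ?_
  have := congr(coeff (Finsupp.single i 1) $h)
  simpa [linearForm_apply, coeff_sum, coeff_C_mul, coeff_X, Finsupp.single_left_inj] using this

theorem exists_linearForm_eq {m : ℕ} {f : MvPolynomial (Fin m) (ZMod q)} (hf : f.IsHomogeneous 1) :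
    ∃ l, linearForm m l = f := by
  rw [← mem_homogeneousSubmodule, homogeneousSubmodule_one_eq_span_X] at hf
  have : Submodule.span (ZMod q) (Set.range X) ≤ LinearMap.range (linearForm (q := q) m) := by
    rw [Submodule.span_le]
    rintro _ ⟨i, rfl⟩
    exact ⟨_, linearForm_proj i⟩
  exact this hf

theorem imageIdeal_linearForm_eq_ker {m : ℕ}
    (W : Submodule (ZMod q) (Module.Dual (ZMod q) (Fin m → ZMod q))) :
    ∃ θ : MvPolynomial (Fin m) (ZMod q) →ₐ[ZMod q] MvPolynomial (Fin m) (ZMod q),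
      imageIdeal (linearForm m) W = RingHom.ker θ ∧ ∀ f, θ (linearForm m f) = 0 → f ∈ W := by
  obtain ⟨W', hW⟩ := Submodule.exists_isCompl W
  set π := W'.projection W hW.symm
  let θ : MvPolynomial (Fin m) (ZMod q) →ₐ[ZMod q] MvPolynomial (Fin m) (ZMod q) :=
    aeval fun i => linearForm m (π (LinearMap.proj i))
  have hθ (f) : θ (linearForm m f) = linearForm m (π f) := by
    have hf : f = ∑ i, f (Pi.single i 1) • LinearMap.proj i := by
      refine LinearMap.pi_ext' fun i => LinearMap.ext_ring ?_
      simp [Pi.single_apply]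
    conv_rhs => rw [hf]
    simp [linearForm_apply f, θ, smul_eq_C_mul, algebraMap_eq]
  have hπ (f) : f - π f ∈ W := by
    rw [← Submodule.projection_apply_eq_zero_iff hW.symm, map_sub, sub_eq_zero]
    exact congr($((Submodule.isIdempotentElem_projection hW.symm).eq.symm) f)
  refine ⟨θ, le_antisymm (Ideal.span_le.2 ?_) ?_, fun f hf => ?_⟩
  · rintro _ ⟨f, hf, rfl⟩
    rw [SetLike.mem_coe, RingHom.mem_ker, hθ,
      (Submodule.projection_apply_eq_zero_iff hW.symm).2 hf, map_zero]
  · intro f hf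
    have h : (Ideal.Quotient.mkₐ (ZMod q) (imageIdeal (linearForm m) W)).comp θ =
        Ideal.Quotient.mkₐ (ZMod q) (imageIdeal (linearForm m) W) := by
      refine algHom_ext fun i => ?_
      rw [AlgHom.comp_apply, ← linearForm_proj, hθ, Ideal.Quotient.mkₐ_eq_mk, eq_comm,
        Ideal.Quotient.mk_eq_mk_iff_sub_mem, ← map_sub]
      exact mem_imageIdeal _ (hπ _)
    have h' := congr($h f)
    rw [AlgHom.comp_apply, show θ f = 0 from hf, map_zero, Ideal.Quotient.mkₐ_eq_mk] at h'
    exact Ideal.Quotient.eq_zero_iff_mem.1 h'.symm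
  · rw [hθ] at hf
    rw [← Submodule.projection_apply_eq_zero_iff hW.symm]
    exact linearForm_injective m (hf.trans (map_zero _).symm)

end LinearForms

section Bound

theorem isIntegral_of_fixed {k S Γ : Type*} [CommRing k] [CommRing S] [Algebra k S] [Group Γ]
    [Finite Γ] (σ : Γ →* (S ≃ₐ[k] S)) (B : Subalgebra k S) (hB : ∀ f, f ∈ B ↔ ∀ g, σ g f = f) :
    Algebra.IsIntegral B S := by
  let : MulSemiringAction Γ S := MulSemiringAction.compHom S σ
  have hsmul (g : Γ) (f : S) : g • f = σ g f := rfl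
  have : SMulCommClass Γ B S := ⟨fun g b f => by
    rw [Algebra.smul_def, Algebra.smul_def, hsmul, map_mul]
    congr 1
    exact (hB b).1 b.2 g⟩
  have : Algebra.IsInvariant B S Γ := ⟨fun f hf => ⟨⟨f, (hB f).2 hf⟩, rfl⟩⟩
  exact Algebra.IsInvariant.isIntegral B S Γ

theorem IsRegularMod.le_of_subalgebra {k S : Type*} [CommRing k] [CommRing S] [Algebra k S]
    {B : Subalgebra k S} [Algebra.IsIntegral B S] {a : ℕ → B} {N e : ℕ}
    (h : IsRegularMod ⊥ N a) (ha : initialIdeal a N ≠ ⊤) (he : ringKrullDim S ≤ e) : N ≤ e := by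
  have := Ideal.Quotient.nontrivial_iff.2 ha
  have h1 : ((0 : WithBot ℕ∞) + N) ≤ e :=
    calc (0 : WithBot ℕ∞) + N ≤ ringKrullDim (B ⧸ initialIdeal a N) + N := by
          gcongr
          exact ringKrullDim_nonneg_of_nontrivial
      _ ≤ ringKrullDim B := h.add_ringKrullDim_le le_rfl
      _ ≤ ringKrullDim S := ringKrullDim_le_of_isIntegral_of_injective Subtype.val_injective
      _ ≤ e := he
  rw [zero_add] at h1
  exact_mod_cast h1

end Bound

section DicksonInvariants

variable {e m q : ℕ} [Fact q.Prime] {Γ : Type*} [Group Γ]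
  {ρ : Representation (ZMod q) Γ (Fin e → ZMod q)}
  {σ : Γ →* (MvPolynomial (Fin e) (ZMod q) ≃ₐ[ZMod q] MvPolynomial (Fin e) (ZMod q))}
  {c : (Fin m → ZMod q) →ₗ[ZMod q] (Fin e → ZMod q)}

theorem restrictAlong_linearForm (f : Module.Dual (ZMod q) (Fin e → ZMod q)) :
    restrictAlong c (linearForm e f) = linearForm m (c.dualMap f) := by
  rw [linearForm_apply, linearForm_apply, map_sum]
  simp only [map_mul, algHom_C, restrictAlong_X, algebraMap_eq, Finset.mul_sum]
  rw [Finset.sum_comm]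
  refine Finset.sum_congr rfl fun l _ => ?_
  simp_rw [← mul_assoc, ← C_mul]
  rw [← Finset.sum_mul, ← map_sum]
  congr 2
  rw [LinearMap.dualMap_apply, LinearMap.pi_apply_eq_sum_univ f (c (Pi.single l 1))]
  refine Finset.sum_congr rfl fun j _ => ?_
  have : (Pi.single j 1 : Fin e → ZMod q) = fun j' => if j = j' then 1 else 0 := by
    ext j'
    simp [Pi.single_apply, eq_comm]
  rw [smul_eq_mul, mul_comm, this]

instance : Finite (Module.Dual (ZMod q) (Fin e → ZMod q)) :=
  Module.finite_of_finite (ZMod q)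

instance : Fintype (Module.Dual (ZMod q) (Fin e → ZMod q)) :=
  Fintype.ofFinite _

theorem imageIdeal_comp {q : ℕ} [Fact q.Prime] {E E' B : Type*} [AddCommGroup E]
    [Module (ZMod q) E] [AddCommGroup E'] [Module (ZMod q) E'] [CommRing B] [Algebra (ZMod q) B]
    (ψ : E' →ₗ[ZMod q] B) (φ : E →ₗ[ZMod q] E') (U : Submodule (ZMod q) E) :
    imageIdeal (ψ ∘ₗ φ) U = imageIdeal ψ (U.map φ) := by
  rw [imageIdeal, imageIdeal, LinearMap.coe_comp, Set.image_comp, Submodule.map_coe]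

/-- The Dickson invariants of the contragredient representation. -/
def dicksonInvariant (e q : ℕ) [Fact q.Prime] (i : ℕ) : MvPolynomial (Fin e) (ZMod q) :=
  (rootPoly (linearForm (q := q) e)).coeff (q ^ i)

theorem card_dual :
    (Finset.univ : Finset (Module.Dual (ZMod q) (Fin e → ZMod q))).card = q ^ e := by
  rw [Finset.card_univ, ← Nat.card_eq_fintype_card, Module.natCard_eq_pow_finrank (K := ZMod q),
    Nat.card_zmod, Subspace.dual_finrank_eq, Module.finrank_fin_fun]

theorem dicksonInvariant_isHomogeneous {i : ℕ} (hi : i ≤ e) :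
    (dicksonInvariant e q i).IsHomogeneous (q ^ e - q ^ i) := by
  refine isHomogeneous_coeff_prod _ linearForm_isHomogeneous _ ?_
  rw [card_dual]
  exact Nat.add_sub_of_le (Nat.pow_le_pow_right (Fact.out : q.Prime).pos hi)

theorem InducedAction.dicksonInvariant_mem (hσ : InducedAction ρ σ) (i : ℕ) :
    dicksonInvariant e q i ∈ fixedSub σ ⊤ := by
  refine mem_fixedSub.2 fun g _ => ?_
  have hhom (f) : (σ g (linearForm e f)).IsHomogeneous 1 :=
    isHomogeneous_algHom (g := (σ g : _ →ₐ[ZMod q] _)) (hσ.isHomogeneous g)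
      (linearForm_isHomogeneous f)
  choose τ hτ using fun f => exists_linearForm_eq (hhom f)
  have hinj : Function.Injective τ := fun f f' h =>
    linearForm_injective e ((σ g).injective ((hτ f).symm.trans (h ▸ hτ f')))
  have hmap : (rootPoly (linearForm (q := q) e)).map (σ g : _ →+* _) =
      rootPoly (linearForm (q := q) e) := by
    rw [map_rootPoly, rootPoly, rootPoly, ← (Finite.injective_iff_bijective.1 hinj).prod_comp
      fun f => Polynomial.X - Polynomial.C (linearForm e f)]
    refine Finset.prod_congr rfl fun f _ => ?_
    rw [hτ]
    rfl
  have := congr(Polynomial.coeff $hmap (q ^ i))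
  rwa [Polynomial.coeff_map] at this

theorem isRegularMod_restrictAlong_dicksonInvariant (hc : Function.Injective c) :
    IsRegularMod ⊥ m (fun j => restrictAlong c (dicksonInvariant e q (e - m + j))) := by
  set φ := c.dualMap
  have hφ : Function.Surjective φ := LinearMap.dualMap_surjective_of_injective hc
  have hker : LinearMap.ker (linearForm m ∘ₗ φ) = LinearMap.ker φ :=
    LinearMap.ker_comp_of_ker_eq_bot _ (LinearMap.ker_eq_bot.2 (linearForm_injective m))
  have hdim : Module.finrank (ZMod q) (LinearMap.ker φ) + m = e := by
    have := φ.finrank_range_add_finrank_ker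
    rw [LinearMap.range_eq_top.2 hφ, finrank_top, Subspace.dual_finrank_eq,
      Subspace.dual_finrank_eq, Module.finrank_fin_fun, Module.finrank_fin_fun] at this
    lia
  have hprime (U) : (imageIdeal (linearForm m ∘ₗ φ) U).IsPrime := by
    obtain ⟨θ, hθ, -⟩ := imageIdeal_linearForm_eq_ker (U.map φ)
    rw [imageIdeal_comp, hθ]
    exact RingHom.ker_isPrime _
  have hmem (U) (u) (hU : LinearMap.ker (linearForm m ∘ₗ φ) ≤ U)
      (hu : (linearForm m ∘ₗ φ) u ∈ imageIdeal (linearForm m ∘ₗ φ) U) : u ∈ U := by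
    obtain ⟨θ, hθ, hθ'⟩ := imageIdeal_linearForm_eq_ker (U.map φ)
    rw [imageIdeal_comp, hθ] at hu
    have := Submodule.mem_comap.2 (hθ' _ hu)
    rwa [Submodule.comap_map_eq_self (hker ▸ hU)] at this
  have hbot : imageIdeal (linearForm m ∘ₗ φ) (LinearMap.ker φ) = ⊥ := by
    rw [imageIdeal, Ideal.span_eq_bot]
    rintro _ ⟨f, hf, rfl⟩
    exact hker.ge hf
  have := isRegularMod_coeff_rootPoly (linearForm m ∘ₗ φ) hprime hmem m (LinearMap.ker φ) hker.le
    (by rw [hdim, Subspace.dual_finrank_eq, Module.finrank_fin_fun])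
  rw [hbot] at this
  convert this using 2 with j
  have hcomp : (restrictAlong c).toRingHom ∘ linearForm e = linearForm m ∘ₗ φ :=
    funext restrictAlong_linearForm
  have hmap := map_rootPoly (restrictAlong c).toRingHom (linearForm e)
  rw [dicksonInvariant, show e - m = Module.finrank (ZMod q) (LinearMap.ker φ) by lia]
  have := congr(Polynomial.coeff $hmap (q ^ (Module.finrank (ZMod q) (LinearMap.ker φ) + j)))
  rw [Polynomial.coeff_map] at this
  rwa [hcomp] at this

theorem isIntegral_fixedSub [Finite Γ] :
    Algebra.IsIntegral (fixedSub σ ⊤) (MvPolynomial (Fin e) (ZMod q)) :=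
  isIntegral_of_fixed σ _ fun f => by simp [mem_fixedSub]

theorem initialIdeal_ne_top_of_isHomogeneous {N : ℕ} {x : ℕ → fixedSub σ ⊤} {d : ℕ → ℕ}
    (hd : ∀ l < N, (x l : MvPolynomial (Fin e) (ZMod q)).IsHomogeneous (d l))
    (hpos : ∀ l < N, 0 < d l) : initialIdeal x N ≠ ⊤ :=
  initialIdeal_ne_top_of_map_eq_zero (constantCoeff.comp (fixedSub σ ⊤).val.toRingHom)
    fun l hl => (hd l hl).coeff_eq_zero (by simpa using (hpos l hl).ne)

theorem InducedAction.le_depth [Fintype Γ] (hσ : InducedAction ρ σ) (P : Sylow q Γ)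
    (hP : ∀ g ∈ (P : Subgroup Γ), ∀ v, ρ g (c v) = c v) (hc : Function.Injective c) :
    m ≤ depth (fixedSub σ ⊤) (fixedSub σ ⊤)
      (RingHom.ker (constantCoeff.comp (fixedSub σ ⊤).val.toRingHom)) := by
  have hme : m ≤ e := by
    simpa using LinearMap.finrank_le_finrank_of_injective hc
  have hq : 1 < q := (Fact.out : q.Prime).one_lt
  refine le_csSup ⟨e, ?_⟩ ?_
  · rintro N ⟨y, -, hy⟩
    obtain ⟨h1, h2⟩ := (isRegSeq_iff_isRegularMod
      (a := fun i => if h : i < N then y ⟨i, h⟩ else 0) fun i => by simp).1 hy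
    have := isIntegral_fixedSub (σ := σ)
    refine h1.le_of_subalgebra h2 ?_
    rw [MvPolynomial.ringKrullDim_of_isNoetherianRing]
    simp
  · set x : ℕ → fixedSub σ ⊤ := fun j =>
      ⟨dicksonInvariant e q (e - m + j), hσ.dicksonInvariant_mem _⟩
    have hd (l) (hl : l < m) : (x l : MvPolynomial (Fin e) (ZMod q)).IsHomogeneous
        (q ^ e - q ^ (e - m + l)) :=
      dicksonInvariant_isHomogeneous (by lia)
    have hpos (l) (hl : l < m) : 0 < q ^ e - q ^ (e - m + l) :=
      Nat.sub_pos_of_lt (Nat.pow_lt_pow_right hq (by lia))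
    refine ⟨fun i => x i, fun i => ?_, (isRegSeq_iff_isRegularMod fun i => rfl).2
      ⟨hσ.isRegularMod P hP hd (isRegularMod_restrictAlong_dicksonInvariant hc),
        initialIdeal_ne_top_of_isHomogeneous hd hpos⟩⟩
    exact (hd i i.2).coeff_eq_zero (by simpa using (hpos i i.2).ne)

theorem InducedAction.isRegSeq [Fintype Γ] (hσ : InducedAction ρ σ) (P : Sylow q Γ)
    (hP : ∀ g ∈ (P : Subgroup Γ), ∀ v, ρ g (c v) = c v) {N : ℕ} {x : Fin N → fixedSub σ ⊤}
    {d : Fin N → ℕ} (hd : ∀ i, (x i : MvPolynomial (Fin e) (ZMod q)).IsHomogeneous (d i))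
    (hpos : ∀ i, 0 < d i)
    (hx : IsRegSeq (MvPolynomial (Fin m) (ZMod q)) fun i => restrictAlong c (x i)) :
    IsRegSeq (fixedSub σ ⊤) x := by
  set y : ℕ → fixedSub σ ⊤ := fun i => if h : i < N then x ⟨i, h⟩ else 0
  have hy (i : Fin N) : y i = x i := by simp [y]
  have hx' := ((isRegSeq_iff_isRegularMod (a := fun l => restrictAlong c (y l))
    fun i => by rw [hy]).1 hx).1
  set d' : ℕ → ℕ := fun i => if h : i < N then d ⟨i, h⟩ else 0
  have hd' (l) (hl : l < N) : (y l : MvPolynomial (Fin e) (ZMod q)).IsHomogeneous (d' l) := by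
    simpa [y, d', hl] using hd ⟨l, hl⟩
  have hpos' (l) (hl : l < N) : 0 < d' l := by
    simpa [d', hl] using hpos ⟨l, hl⟩
  exact (isRegSeq_iff_isRegularMod hy).2
    ⟨hσ.isRegularMod P hP hd' hx', initialIdeal_ne_top_of_isHomogeneous hd' hpos'⟩

end DicksonInvariants

/-- Duflot's theorem in modular invariant theory: if the restrictions to a subspace
`C ⊆ V^P` (`P` a Sylow `p`-subgroup) of homogeneous positive-degree invariants
`x_1, ..., x_N ∈ F_p[V]^G` form a regular sequence in `F_p[C]`, then `x_1, ..., x_N` is a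
regular sequence in `F_p[V]^G`; in particular `depth F_p[V]^G ≥ dim_{F_p} V^P`. -/
theorem stmt17 (ρ : Representation (ZMod p) G (Fin n → ZMod p))
    (hfaithful : Function.Injective ρ)
    (hp : p ∣ Fintype.card G)
    (σ : G →* (MvPolynomial (Fin n) (ZMod p) ≃ₐ[ZMod p] MvPolynomial (Fin n) (ZMod p)))
    (hσ : InducedAction ρ σ) (P : Sylow p G)
    (fixedV : Submodule (ZMod p) (Fin n → ZMod p))
    (hfixedV : ∀ v, v ∈ fixedV ↔ ∀ g ∈ (P : Subgroup G), ρ g v = v) :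
    (∀ (m : ℕ) (c : (Fin m → ZMod p) →ₗ[ZMod p] (Fin n → ZMod p)),
      Function.Injective c → LinearMap.range c ≤ fixedV →
      ∀ (N : ℕ) (x : Fin N → MvPolynomial (Fin n) (ZMod p)) (d : Fin N → ℕ),
        (∀ i, (x i).IsHomogeneous (d i)) → (∀ i, 0 < d i) →
        ∀ hx : ∀ i, x i ∈ fixedSub σ ⊤,
        IsRegSeq (MvPolynomial (Fin m) (ZMod p))
          (fun i => aeval (R := ZMod p)
            (fun i' : Fin n => ∑ j : Fin m, C (c (Pi.single j (1 : ZMod p)) i') * X j)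
            (x i)) →
        IsRegSeq ((fixedSub σ ⊤) : Type _)
          (fun i => (⟨x i, hx i⟩ : fixedSub σ ⊤))) ∧
    Module.finrank (ZMod p) fixedV ≤
      depth (fixedSub σ ⊤) (fixedSub σ ⊤)
        (RingHom.ker ((constantCoeff (R := ZMod p)).comp (fixedSub σ ⊤).val.toRingHom)) := by
  refine ⟨fun m c _ hc N x d hd hpos hx hreg => ?_, ?_⟩
  · exact hσ.isRegSeq (x := fun i => ⟨x i, hx i⟩) P
      (fun g hg v => (hfixedV _).1 (hc ⟨v, rfl⟩) g hg) hd hpos hreg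
  · let b := (Module.finBasis (ZMod p) fixedV).equivFun.symm
    exact hσ.le_depth (c := fixedV.subtype ∘ₗ (b : _ →ₗ[ZMod p] fixedV)) P
      (fun g hg v => (hfixedV _).1 (b v).2 g hg) (Subtype.val_injective.comp b.injective)

end
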